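/- arXiv:2509.17904 — 5 statements merged into one kernel-verified Lean document; each statement's English description precedes it below -/
import Mathlib

section
/- Let G be a group, A, B ⊆ G and k ∈ ℕ with k ≥ 1. If A is k-thick in B, then there is a set Δ ⊆ B with |Δ| ≤ k such that B ⊆ Δ·(A ∪ A⁻¹). -/
open Pointwise

/-- `A` is `k`-thick in `B`: among any `k+1` elements of `B`, two of them
`bᵢ, bⱼ` (with `i ≠ j`) satisfy `bᵢ⁻¹ * bⱼ ∈ A`. -/
def IsThickIn {G : Type*} [Group G] (k : ℕ) (A B : Set G) : Prop :=
  ∀ b : Fin (k + 1) → G, (∀ i, b i ∈ B) → ∃ i j, i ≠ j ∧ (b i)⁻¹ * b j ∈ A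

/-- If `A` is `k`-thick in `B` with `k ≥ 1`, then there is `Δ ⊆ B`
with `|Δ| ≤ k` and `B ⊆ Δ * (A ∪ A⁻¹)`. -/
theorem stmt_1 {G : Type*} [Group G] (A B : Set G) (k : ℕ) (hk : 1 ≤ k)
    (h : IsThickIn k A B) :
    ∃ Δ : Set G, Δ ⊆ B ∧ Δ.Finite ∧ Δ.ncard ≤ k ∧ B ⊆ Δ * (A ∪ A⁻¹) := by
  by_contra! hcon
  have separated : ∀ n ≤ k + 1, ∃ f : Fin n → G, (∀ i, f i ∈ B) ∧
      ∀ i j, i ≠ j → (f i)⁻¹ * f j ∉ A := by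
    intro n
    induction n with
    | zero => exact fun _ => ⟨Fin.elim0, fun i => i.elim0, fun i => i.elim0⟩
    | succ n ih =>
      intro hn
      obtain ⟨f, hfB, hf⟩ := ih (by omega)
      have hcard : (Set.range f).ncard ≤ k := by
        rw [← Set.image_univ]
        refine (Set.ncard_image_le Set.finite_univ).trans ?_
        rw [Set.ncard_univ, Nat.card_eq_fintype_card, Fintype.card_fin]
        omega
      obtain ⟨b, hbB, hb⟩ := Set.not_subset.1
        (hcon _ (Set.range_subset_iff.2 hfB) (Set.finite_range f) hcard)
      have hb' : ∀ i, (f i)⁻¹ * b ∉ A ∪ A⁻¹ := fun i hi =>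
        hb (Set.mem_mul.2 ⟨f i, Set.mem_range_self i, _, hi, mul_inv_cancel_left _ _⟩)
      refine ⟨Fin.cons b f, Fin.cases hbB hfB, ?_⟩
      intro i j
      cases i using Fin.cases with
      | zero =>
        cases j using Fin.cases with
        | zero => exact fun hij => absurd rfl hij
        | succ j =>
          intro _ hA
          exact hb' j (Or.inr (by simpa using hA))
      | succ i =>
        cases j using Fin.cases with
        | zero =>
          intro _ hA
          exact hb' i (Or.inl (by simpa using hA))
        | succ j =>
          intro hij
          simpa using hf i j fun hc => hij (congrArg Fin.succ hc)
  obtain ⟨f, hfB, hf⟩ := separated (k + 1) le_rfl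
  obtain ⟨i, j, hij, hA⟩ := h f hfB
  exact hf i j hij hA
end

section
/- Let G be a group, Λ ⊆ G, and (G, 𝒜, μ) a mean space on G invariant by left translations. Let A, C ∈ 𝒜 with Λ·A ⊆ C and 0 < μ(A) ≤ μ(C) < ∞. Then for every W ∈ 𝒜 with W ⊆ A and μ(W) > 0, the set S_μ = {g ∈ Λ⁻¹·Λ : μ(gW ∩ W) > 0} is ⌊μ(C)/μ(W)⌋-thick in Λ. -/
open Pointwise ENNReal

/-- A mean space: a lattice of sets `𝒜` containing `∅` together with a
monotone additive function `μ` with `μ ∅ = 0`. -/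
structure IsMeanSpace {E : Type*} (𝒜 : Set (Set E)) (μ : Set E → ℝ≥0∞) : Prop where
  empty_mem : ∅ ∈ 𝒜
  union_mem : ∀ A ∈ 𝒜, ∀ B ∈ 𝒜, A ∪ B ∈ 𝒜
  inter_mem : ∀ A ∈ 𝒜, ∀ B ∈ 𝒜, A ∩ B ∈ 𝒜
  measure_empty : μ ∅ = 0
  mono : ∀ A ∈ 𝒜, ∀ B ∈ 𝒜, A ⊆ B → μ A ≤ μ B
  union_add : ∀ A ∈ 𝒜, ∀ B ∈ 𝒜, μ (A ∩ B) < ⊤ → μ (A ∪ B) = μ A + μ B - μ (A ∩ B)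

/-- A mean space on a group is invariant by left translations. -/
def IsLeftInvariant {G : Type*} [Group G] (𝒜 : Set (Set G)) (μ : Set G → ℝ≥0∞) : Prop :=
  ∀ g : G, ∀ A ∈ 𝒜, g • A ∈ 𝒜 ∧ μ (g • A) = μ A

theorem IsMeanSpace.biUnion_mem {E ι : Type*} {𝒜 : Set (Set E)} {μ : Set E → ℝ≥0∞}
    (h : IsMeanSpace 𝒜 μ) {f : ι → Set E} (s : Finset ι) (hf : ∀ i ∈ s, f i ∈ 𝒜) :
    (⋃ i ∈ s, f i) ∈ 𝒜 := by
  classical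
  induction s using Finset.induction_on with
  | empty => simpa using h.empty_mem
  | insert a s _ ih =>
    rw [Finset.set_biUnion_insert]
    exact h.union_mem _ (hf a (s.mem_insert_self a)) _
      (ih fun i hi => hf i (Finset.mem_insert_of_mem hi))

theorem IsMeanSpace.biUnion_null {E ι : Type*} {𝒜 : Set (Set E)} {μ : Set E → ℝ≥0∞}
    (h : IsMeanSpace 𝒜 μ) {f : ι → Set E} (s : Finset ι) (hf : ∀ i ∈ s, f i ∈ 𝒜)
    (hμ : ∀ i ∈ s, μ (f i) = 0) : μ (⋃ i ∈ s, f i) = 0 := by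
  classical
  induction s using Finset.induction_on with
  | empty => simpa using h.measure_empty
  | insert a s _ ih =>
    have ha := hf a (s.mem_insert_self a)
    have hs : ∀ i ∈ s, f i ∈ 𝒜 := fun i hi => hf i (Finset.mem_insert_of_mem hi)
    have hμa := hμ a (s.mem_insert_self a)
    have hμs := ih hs fun i hi => hμ i (Finset.mem_insert_of_mem hi)
    have hU := h.biUnion_mem s hs
    have hinter : μ (f a ∩ ⋃ i ∈ s, f i) < ⊤ :=
      (h.mono _ (h.inter_mem _ ha _ hU) _ ha Set.inter_subset_left).trans_lt (by simp [hμa])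
    rw [Finset.set_biUnion_insert, h.union_add _ ha _ hU hinter, hμa, hμs]
    simp

theorem IsMeanSpace.measure_biUnion {E ι : Type*} {𝒜 : Set (Set E)} {μ : Set E → ℝ≥0∞}
    (h : IsMeanSpace 𝒜 μ) {f : ι → Set E} (s : Finset ι) (hf : ∀ i ∈ s, f i ∈ 𝒜)
    (hμ : ∀ i ∈ s, ∀ j ∈ s, i ≠ j → μ (f i ∩ f j) = 0) :
    μ (⋃ i ∈ s, f i) = ∑ i ∈ s, μ (f i) := by
  classical
  induction s using Finset.induction_on with
  | empty => simpa using h.measure_empty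
  | insert a s has ih =>
    have ha := hf a (s.mem_insert_self a)
    have hs : ∀ i ∈ s, f i ∈ 𝒜 := fun i hi => hf i (Finset.mem_insert_of_mem hi)
    have hinter : μ (f a ∩ ⋃ i ∈ s, f i) = 0 := by
      rw [Set.inter_iUnion₂]
      exact h.biUnion_null s (fun i hi => h.inter_mem _ ha _ (hs i hi)) fun i hi =>
        hμ a (s.mem_insert_self a) i (Finset.mem_insert_of_mem hi) fun e => has (e ▸ hi)
    rw [Finset.set_biUnion_insert, h.union_add _ ha _ (h.biUnion_mem s hs) (by simp [hinter]),
      hinter, tsub_zero, Finset.sum_insert has, ih hs fun i hi j hj =>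
        hμ i (Finset.mem_insert_of_mem hi) j (Finset.mem_insert_of_mem hj)]

theorem IsLeftInvariant.measure_smul_inter_smul {G : Type*} [Group G] {𝒜 : Set (Set G)}
    {μ : Set G → ℝ≥0∞} (hmean : IsMeanSpace 𝒜 μ) (hinv : IsLeftInvariant 𝒜 μ)
    {W : Set G} (hW : W ∈ 𝒜) (x y : G) :
    μ (x • W ∩ y • W) = μ ((x⁻¹ * y) • W ∩ W) := by
  rw [← (hinv x _ (hmean.inter_mem _ (hinv (x⁻¹ * y) _ hW).1 _ hW)).2, Set.smul_set_inter,
    smul_smul, mul_inv_cancel_left, Set.inter_comm]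

/-- For a left-invariant mean space on `G`, `Λ·A ⊆ C` with
`0 < μ(A) ≤ μ(C) < ∞`, and `W ⊆ A` in `𝒜` with `μ(W) > 0`, the set
`S_μ = {g ∈ Λ⁻¹·Λ : μ(gW ∩ W) > 0}` is `⌊μ(C)/μ(W)⌋`-thick in `Λ`. -/
theorem stmt_5 {G : Type*} [Group G] (Λ : Set G)
    (𝒜 : Set (Set G)) (μ : Set G → ℝ≥0∞)
    (hmean : IsMeanSpace 𝒜 μ) (hinv : IsLeftInvariant 𝒜 μ)
    (A C : Set G) (hA : A ∈ 𝒜) (hC : C ∈ 𝒜) (hΛA : Λ * A ⊆ C)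
    (hA0 : 0 < μ A) (hAC : μ A ≤ μ C) (hCfin : μ C < ⊤)
    (W : Set G) (hW : W ∈ 𝒜) (hWA : W ⊆ A) (hW0 : 0 < μ W) :
    IsThickIn ⌊(μ C / μ W).toReal⌋₊ {g : G | g ∈ Λ⁻¹ * Λ ∧ 0 < μ (g • W ∩ W)} Λ := by
  intro b hb
  by_contra! hcon
  have hnull : ∀ i j, i ≠ j → μ (b i • W ∩ b j • W) = 0 := fun i j hij => by
    rw [hinv.measure_smul_inter_smul hmean hW]
    by_contra hne
    exact hcon i j hij
      ⟨Set.mul_mem_mul (Set.inv_mem_inv.2 (hb i)) (hb j), pos_iff_ne_zero.2 hne⟩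
  have hmem : ∀ i ∈ Finset.univ, b i • W ∈ 𝒜 := fun i _ => (hinv (b i) W hW).1
  have hsub : (⋃ i ∈ Finset.univ, b i • W) ⊆ C := Set.iUnion₂_subset fun i _ =>
    (Set.smul_set_subset_mul (hb i)).trans ((Set.mul_subset_mul_left hWA).trans hΛA)
  have hle := hmean.mono _ (hmean.biUnion_mem _ hmem) _ hC hsub
  rw [hmean.measure_biUnion _ hmem fun i _ j _ => hnull i j,
    Finset.sum_congr rfl fun i _ => (hinv (b i) W hW).2, Finset.sum_const, Finset.card_univ,
    Fintype.card_fin, nsmul_eq_mul] at hle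
  have hWfin : μ W ≠ ⊤ := ((hmean.mono _ hW _ hA hWA).trans_lt (hAC.trans_lt hCfin)).ne
  have hdiv := (ENNReal.le_div_iff_mul_le (.inl hW0.ne') (.inl hWfin)).2 hle
  have hreal := ENNReal.toReal_mono (ENNReal.div_lt_top hCfin.ne hW0.ne').ne hdiv
  rw [ENNReal.toReal_natCast] at hreal
  exact (Nat.lt_succ_self _).not_ge (Nat.le_floor hreal)
end

section
/- Let G be a group, Λ ⊆ G, and (G, 𝒜, μ) a mean space on G invariant by left translations. Let A, C ∈ 𝒜 with Λ·A ⊆ C and 0 < μ(A) ≤ μ(C) < ∞. Then for every W ∈ 𝒜 with W ⊆ A and μ(W) > 0, the set {g ∈ Λ⁻¹·Λ : μ(gW ∩ W) ≥ μ(W)²/(2μ(C))} is ⌈2μ(C)/μ(W)⌉-thick in Λ. -/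
open Pointwise ENNReal

namespace IsMeanSpace

variable {E ι : Type*} {𝒜 : Set (Set E)} {μ : Set E → ℝ≥0∞}

theorem union_add_inter (h : IsMeanSpace 𝒜 μ) {A B : Set E} (hA : A ∈ 𝒜) (hB : B ∈ 𝒜) :
    μ (A ∪ B) + μ (A ∩ B) = μ A + μ B := by
  have hAB := h.inter_mem A hA B hB
  have hle : μ (A ∩ B) ≤ μ A := h.mono _ hAB _ hA Set.inter_subset_left
  rcases eq_or_ne (μ (A ∩ B)) ⊤ with htop | hfin
  · rw [htop, top_le_iff] at hle
    simp [htop, hle]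
  · rw [h.union_add A hA B hB hfin.lt_top, tsub_add_cancel_of_le (hle.trans le_self_add)]

theorem biUnion_mem_s6 (h : IsMeanSpace 𝒜 μ) (s : Finset ι) {V : ι → Set E}
    (hV : ∀ i ∈ s, V i ∈ 𝒜) : (⋃ i ∈ s, V i) ∈ 𝒜 := by
  classical
  induction s using Finset.induction_on with
  | empty => simpa using h.empty_mem
  | insert a s _ ih =>
    rw [Finset.set_biUnion_insert]
    exact h.union_mem _ (hV a (Finset.mem_insert_self a s)) _
      (ih fun i hi => hV i (Finset.mem_insert_of_mem hi))

theorem measure_biUnion_le (h : IsMeanSpace 𝒜 μ) (s : Finset ι) {V : ι → Set E}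
    (hV : ∀ i ∈ s, V i ∈ 𝒜) : μ (⋃ i ∈ s, V i) ≤ ∑ i ∈ s, μ (V i) := by
  classical
  induction s using Finset.induction_on with
  | empty => simp [h.measure_empty]
  | insert a s ha ih =>
    have hs : ∀ i ∈ s, V i ∈ 𝒜 := fun i hi => hV i (Finset.mem_insert_of_mem hi)
    rw [Finset.set_biUnion_insert, Finset.sum_insert ha]
    calc μ (V a ∪ ⋃ i ∈ s, V i)
        ≤ μ (V a ∪ ⋃ i ∈ s, V i) + μ (V a ∩ ⋃ i ∈ s, V i) := le_self_add
      _ = μ (V a) + μ (⋃ i ∈ s, V i) :=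
          h.union_add_inter (hV a (Finset.mem_insert_self a s)) (h.biUnion_mem_s6 s hs)
      _ ≤ _ := by gcongr; exact ih hs

/-- A Bonferroni inequality: a union of sets of measure at least `w` with pairwise intersections
of measure at most `e`. -/
theorem card_mul_le_measure_biUnion_add (h : IsMeanSpace 𝒜 μ) (s : Finset ι) {V : ι → Set E}
    {w e : ℝ≥0∞} (hV : ∀ i ∈ s, V i ∈ 𝒜) (hw : ∀ i ∈ s, w ≤ μ (V i))
    (he : ∀ i ∈ s, ∀ j ∈ s, i ≠ j → μ (V i ∩ V j) ≤ e) :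
    s.card * w ≤ μ (⋃ i ∈ s, V i) + s.card.choose 2 * e := by
  classical
  induction s using Finset.induction_on with
  | empty => simp
  | insert a s ha ih =>
    have hm : ∀ {i}, i ∈ s → i ∈ insert a s := Finset.mem_insert_of_mem
    have ha' := Finset.mem_insert_self a s
    have hs : ∀ i ∈ s, V i ∈ 𝒜 := fun i hi => hV i (hm hi)
    have ih := ih hs (fun i hi => hw i (hm hi)) (fun i hi j hj => he i (hm hi) j (hm hj))
    have hinter : μ (V a ∩ ⋃ i ∈ s, V i) ≤ s.card * e := by
      rw [Set.inter_iUnion₂, ← nsmul_eq_mul]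
      refine (h.measure_biUnion_le s fun i hi => h.inter_mem _ (hV a ha') _ (hs i hi)).trans
        (Finset.sum_le_card_nsmul _ _ _ fun i hi => he a ha' i (hm hi) ?_)
      rintro rfl
      exact ha hi
    rw [Finset.set_biUnion_insert, Finset.card_insert_of_notMem ha, Nat.choose_succ_succ' s.card 1,
      Nat.choose_one_right]
    push_cast
    calc ((s.card : ℝ≥0∞) + 1) * w = w + s.card * w := by ring
      _ ≤ μ (V a) + (μ (⋃ i ∈ s, V i) + s.card.choose 2 * e) := by
          gcongr
          exact hw a ha'
      _ = μ (V a ∪ ⋃ i ∈ s, V i) + μ (V a ∩ ⋃ i ∈ s, V i) + s.card.choose 2 * e := by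
          rw [h.union_add_inter (hV a ha') (h.biUnion_mem_s6 s hs), add_assoc]
      _ ≤ μ (V a ∪ ⋃ i ∈ s, V i) + s.card * e + s.card.choose 2 * e := by gcongr
      _ = _ := by ring

end IsMeanSpace

theorem add_choose_two_mul_lt_succ_ceil_mul {w c : ℝ} (hw : 0 < w) (hwc : w ≤ c) :
    c + (⌈2 * c / w⌉₊ + 1).choose 2 * (w ^ 2 / (2 * c)) < (⌈2 * c / w⌉₊ + 1 : ℕ) * w := by
  have hc : 0 < c := hw.trans_le hwc
  rw [Nat.cast_choose_two]
  push_cast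
  set x := 2 * c / w with hx
  have hx2 : 2 ≤ x := by rw [hx, le_div_iff₀ hw]; linarith
  have hk1 : x ≤ ⌈x⌉₊ := Nat.le_ceil x
  have hk2 : (⌈x⌉₊ : ℝ) < x + 1 := Nat.ceil_lt_add_one (by linarith)
  have hcx : c = x * w / 2 := by rw [hx]; field_simp
  have he : w ^ 2 / (2 * c) = w / x := by rw [hx]; field_simp
  rw [he, hcx]
  generalize (⌈x⌉₊ : ℝ) = k at *
  have hx0 : 0 < x := by linarith
  have key : x ^ 2 + (k + 1) * k < 2 * x * (k + 1) := by nlinarith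
  have : x * w / 2 + (k + 1) * (k + 1 - 1) / 2 * (w / x)
      = (x ^ 2 + (k + 1) * k) * (w / (2 * x)) := by field_simp; ring
  rw [this]
  calc _ < 2 * x * (k + 1) * (w / (2 * x)) := by gcongr
    _ = (k + 1) * w := by field_simp

/-- For a left-invariant mean space on `G`, `Λ·A ⊆ C` with
`0 < μ(A) ≤ μ(C) < ∞`, and `W ⊆ A` in `𝒜` with `μ(W) > 0`, the set
`{g ∈ Λ⁻¹·Λ : μ(gW ∩ W) ≥ μ(W)²/(2μ(C))}` is `⌈2μ(C)/μ(W)⌉`-thick in `Λ`. -/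
theorem stmt_6 {G : Type*} [Group G] (Λ : Set G)
    (𝒜 : Set (Set G)) (μ : Set G → ℝ≥0∞)
    (hmean : IsMeanSpace 𝒜 μ) (hinv : IsLeftInvariant 𝒜 μ)
    (A C : Set G) (hA : A ∈ 𝒜) (hC : C ∈ 𝒜) (hΛA : Λ * A ⊆ C)
    (hA0 : 0 < μ A) (hAC : μ A ≤ μ C) (hCfin : μ C < ⊤)
    (W : Set G) (hW : W ∈ 𝒜) (hWA : W ⊆ A) (hW0 : 0 < μ W) :
    IsThickIn ⌈(2 * μ C / μ W).toReal⌉₊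
      {g : G | g ∈ Λ⁻¹ * Λ ∧ μ W ^ 2 / (2 * μ C) ≤ μ (g • W ∩ W)} Λ := by
  intro b hb
  by_contra! hcon
  have hwc : μ W ≤ μ C := (hmean.mono W hW A hA hWA).trans hAC
  have hwfin : μ W ≠ ⊤ := (hwc.trans_lt hCfin).ne
  have hV : ∀ i ∈ Finset.univ, b i • W ∈ 𝒜 := fun i _ => (hinv (b i) W hW).1
  have hinter : ∀ i ∈ Finset.univ, ∀ j ∈ Finset.univ, i ≠ j →
      μ (b i • W ∩ b j • W) ≤ μ W ^ 2 / (2 * μ C) := by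
    intro i _ j _ hij
    by_contra! hlt
    refine hcon i j hij ⟨Set.mul_mem_mul (Set.inv_mem_inv.2 (hb i)) (hb j), ?_⟩
    have hmem := hmean.inter_mem _ (hinv ((b i)⁻¹ * b j) W hW).1 _ hW
    rw [← (hinv (b i) _ hmem).2, Set.smul_set_inter, smul_smul, mul_inv_cancel_left,
      Set.inter_comm]
    exact hlt.le
  have hle := hmean.card_mul_le_measure_biUnion_add Finset.univ hV
    (fun i _ => (hinv (b i) W hW).2.ge) hinter
  have hsub : (⋃ i ∈ Finset.univ, b i • W) ⊆ C := by
    refine Set.iUnion₂_subset fun i _ => ?_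
    rintro _ ⟨x, hx, rfl⟩
    exact hΛA (Set.mul_mem_mul (hb i) (hWA hx))
  have hle := hle.trans (add_le_add_left (hmean.mono _ (hmean.biUnion_mem_s6 _ hV) C hC hsub) _)
  rw [Finset.card_univ, Fintype.card_fin] at hle
  have hC0 : 2 * μ C ≠ 0 := mul_ne_zero two_ne_zero (hW0.trans_le hwc).ne'
  have hefin : μ W ^ 2 / (2 * μ C) ≠ ⊤ := ENNReal.div_ne_top (ENNReal.pow_ne_top hwfin) hC0
  have hmfin := ENNReal.mul_ne_top
    (ENNReal.natCast_ne_top ((⌈(2 * μ C / μ W).toReal⌉₊ + 1).choose 2)) hefin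
  have hreal := ENNReal.toReal_mono (ENNReal.add_ne_top.2 ⟨hCfin.ne, hmfin⟩) hle
  rw [ENNReal.toReal_add hCfin.ne hmfin] at hreal
  simp only [ENNReal.toReal_mul, ENNReal.toReal_div, ENNReal.toReal_pow, ENNReal.toReal_natCast,
    ENNReal.toReal_ofNat] at hreal
  exact hreal.not_gt (add_choose_two_mul_lt_succ_ceil_mul
    (ENNReal.toReal_pos hW0.ne' hwfin) (ENNReal.toReal_mono hCfin.ne hwc))
end

section
/- Let G be a group and Λ, Γ ⊆ G with Γ symmetric (Γ⁻¹ = Γ). If ℓ = (ℓ_k)_{k∈ℕ} is a thick Massicot-Wagner system in Λ relative to Γ, then ℓ is a Massicot-Wagner system in Λ relative to Γ. -/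
open Pointwise

/-- `A` is thick in `B`: there is `k` such that among any `k+1` elements of `B`,
two of them `bᵢ, bⱼ` (with `i ≠ j`) satisfy `bᵢ⁻¹ * bⱼ ∈ A`. -/
def ThickIn {G : Type*} [Group G] (A B : Set G) : Prop :=
  ∃ k : ℕ, ∀ b : Fin (k + 1) → G, (∀ i, b i ∈ B) → ∃ i j, i ≠ j ∧ (b i)⁻¹ * b j ∈ A

/-- A Massicot-Wagner system in `Λ` relative to `Γ`: a sequence of families of
nonempty subsets of `G` such that for `W ∈ ℓ_{k+1}`, `Λ` is covered by finitely
many left translates of `{g ∈ Γ : gW ∩ W ∈ ℓ_k or g⁻¹W ∩ W ∈ ℓ_k}`. -/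
def IsMWSystem {G : Type*} [Group G] (Λ Γ : Set G) (ℓ : ℕ → Set (Set G)) : Prop :=
  (∀ k, ∀ W ∈ ℓ k, W.Nonempty) ∧
  ∀ k, ∀ W ∈ ℓ (k + 1), ∃ Δ : Set G, Δ.Finite ∧
    Λ ⊆ Δ * {g ∈ Γ | g • W ∩ W ∈ ℓ k ∨ g⁻¹ • W ∩ W ∈ ℓ k}

/-- A thick Massicot-Wagner system in `Λ` relative to `Γ`: a sequence of
families of nonempty subsets of `G` such that for `W ∈ ℓ_{k+1}`, the set
`{g ∈ Γ : gW ∩ W ∈ ℓ_k or g⁻¹W ∩ W ∈ ℓ_k}` is thick in `Λ`. -/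
def IsThickMWSystem {G : Type*} [Group G] (Λ Γ : Set G) (ℓ : ℕ → Set (Set G)) : Prop :=
  (∀ k, ∀ W ∈ ℓ k, W.Nonempty) ∧
  ∀ k, ∀ W ∈ ℓ (k + 1),
    ThickIn {g ∈ Γ | g • W ∩ W ∈ ℓ k ∨ g⁻¹ • W ∩ W ∈ ℓ k} Λ

/-- If a symmetric set `A` is thick in `B`, then finitely many left translates of `A` cover `B`. -/
theorem ThickIn.exists_finite_subset_mul {G : Type*} [Group G] {A B : Set G}
    (hA : A⁻¹ = A) (h : ThickIn A B) : ∃ Δ : Set G, Δ.Finite ∧ B ⊆ Δ * A := by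
  by_contra! hcover
  obtain ⟨k, hk⟩ := h
  obtain ⟨f, hfB, hf⟩ := exists_seq_of_forall_finset_exists (· ∈ B) (fun x y => x⁻¹ * y ∉ A)
    fun s _ => by
      obtain ⟨y, hyB, hy⟩ := Set.not_subset.mp (hcover s s.finite_toSet)
      exact ⟨y, hyB, fun x hx hxy => hy ⟨x, hx, x⁻¹ * y, hxy, mul_inv_cancel_left x y⟩⟩
  obtain ⟨i, j, hij, hmem⟩ := hk (fun i => f i) fun i => hfB i
  rcases lt_or_gt_of_ne hij with hlt | hlt
  · exact hf i j hlt hmem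
  · apply hf j i hlt
    rw [← hA, Set.mem_inv, mul_inv_rev, inv_inv]
    exact hmem

/-- Every thick Massicot-Wagner system (relative to a symmetric
set `Γ`) is a Massicot-Wagner system. -/
theorem stmt_12 {G : Type*} [Group G] (Λ Γ : Set G) (hΓ : Γ⁻¹ = Γ)
    (ℓ : ℕ → Set (Set G)) (h : IsThickMWSystem Λ Γ ℓ) :
    IsMWSystem Λ Γ ℓ := by
  refine ⟨h.1, fun k W hW => (h.2 k W hW).exists_finite_subset_mul ?_⟩
  ext g
  have hg : g⁻¹ ∈ Γ ↔ g ∈ Γ := by rw [← Set.mem_inv, hΓ]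
  simp only [Set.mem_inv, Set.mem_ofPred_eq, inv_inv, hg, or_comm]
end

section
/- Let G be a group and Λ, Γ ⊆ G. If ℓ = (ℓ_k)_{k∈ℕ} is a thick Massicot-Wagner system in Λ relative to Γ, then for any Λ₀ ⊆ Λ, ℓ is a thick Massicot-Wagner system in Λ₀ relative to Γ ∩ (Λ₀⁻¹·Λ₀). -/
open Pointwise

/-- Thickness in `B` passes to any `C ⊆ B`, after intersecting with `C⁻¹ * C`. -/
theorem ThickIn.inter_inv_mul {G : Type*} [Group G] {A B C : Set G} (h : ThickIn A B)
    (hC : C ⊆ B) : ThickIn (A ∩ (C⁻¹ * C)) C := by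
  obtain ⟨k, hk⟩ := h
  refine ⟨k, fun b hb => ?_⟩
  obtain ⟨i, j, hij, hA⟩ := hk b fun i => hC (hb i)
  exact ⟨i, j, hij, hA, Set.mul_mem_mul (Set.inv_mem_inv.2 (hb i)) (hb j)⟩

/-- A thick Massicot-Wagner system in `Λ` relative to `Γ` is a
thick Massicot-Wagner system in `Λ₀` relative to `Γ ∩ (Λ₀⁻¹ * Λ₀)` for any
`Λ₀ ⊆ Λ`. -/
theorem stmt_13 {G : Type*} [Group G] (Λ Γ : Set G) (ℓ : ℕ → Set (Set G))
    (h : IsThickMWSystem Λ Γ ℓ) (Λ₀ : Set G) (hΛ₀ : Λ₀ ⊆ Λ) :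
    IsThickMWSystem Λ₀ (Γ ∩ (Λ₀⁻¹ * Λ₀)) ℓ := by
  refine ⟨h.1, fun k W hW => ?_⟩
  convert (h.2 k W hW).inter_inv_mul hΛ₀ using 1
  exact Set.ext fun g => and_right_comm
end
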